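/- arXiv:2008.11330 — 10 statements merged into one kernel-verified Lean document; each statement's English description precedes it below -/
import Mathlib

section
/- (Deterministic core of Theorem 1.) Let C be a real symmetric n×n matrix whose largest eigenvalue λ₁ is simple (λ₁ > λ₂), with associated unit eigenvector u having strictly positive entries. Let (Ĉ_m) be a sequence of real symmetric n×n matrices with ‖Ĉ_m − C‖₂ → 0 as m → ∞, let v̂_m be any unit eigenvector of Ĉ_m associated with its largest eigenvalue, and let û_m = sgn(⟨v̂_m, 1⟩) · v̂_m be its sign-corrected version. Then for every pair of indices i, j with u_i < u_j there exists M such that for all m ≥ M, (û_m)_i < (û_m)_j. -/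
open Filter Topology

/-- The ℓ₂ operator (spectral) norm of a real square matrix. -/
noncomputable def l2OpNorm {n : ℕ} (M : Matrix (Fin n) (Fin n) ℝ) : ℝ :=
  ‖Matrix.toEuclideanCLM (𝕜 := ℝ) M‖

/-- If every real eigenvalue of a symmetric matrix is at most `t`, its quadratic form is at most
`t` times the squared Euclidean norm. -/
theorem Matrix.IsSymm.dotProduct_mulVec_le_of_forall_eigenvalue_le {ι : Type*} [Fintype ι]
    [DecidableEq ι] {A : Matrix ι ι ℝ} (hA : A.IsSymm) {t : ℝ}
    (ht : ∀ (ν : ℝ) (x : ι → ℝ), x ≠ 0 → A.mulVec x = ν • x → ν ≤ t) (x : ι → ℝ) :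
    x ⬝ᵥ A.mulVec x ≤ t * (x ⬝ᵥ x) := by
  have hH : (t • (1 : Matrix ι ι ℝ) - A).IsHermitian := by
    rw [Matrix.IsHermitian, Matrix.conjTranspose_eq_transpose_of_trivial, Matrix.transpose_sub,
      Matrix.transpose_smul, Matrix.transpose_one, hA.eq]
  have hP : (t • (1 : Matrix ι ι ℝ) - A).PosSemidef := by
    rw [hH.posSemidef_iff_eigenvalues_nonneg]
    intro k
    have hk := hH.mulVec_eigenvectorBasis k
    rw [Matrix.sub_mulVec, Matrix.smul_mulVec, Matrix.one_mulVec] at hk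
    have hle := ht (t - hH.eigenvalues k) (hH.eigenvectorBasis k)
      (fun h => hH.eigenvectorBasis.orthonormal.ne_zero k (WithLp.ofLp_injective 2 h))
      (by rw [sub_smul, ← hk, sub_sub_cancel])
    simpa using hle
  have h := hP.dotProduct_mulVec_nonneg x
  rw [Matrix.sub_mulVec, Matrix.smul_mulVec, Matrix.one_mulVec, dotProduct_sub,
    dotProduct_smul, star_trivial, smul_eq_mul] at h
  linarith

/-- Convergence in spectral norm implies entrywise convergence. -/
theorem tendsto_of_tendsto_l2OpNorm_sub {n : ℕ} {α : Type*} {l : Filter α}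
    {A : α → Matrix (Fin n) (Fin n) ℝ} {B : Matrix (Fin n) (Fin n) ℝ}
    (h : Tendsto (fun a => l2OpNorm (A a - B)) l (𝓝 0)) : Tendsto A l (𝓝 B) := by
  refine tendsto_pi_nhds.2 fun i => tendsto_pi_nhds.2 fun j => ?_
  rw [tendsto_iff_norm_sub_tendsto_zero]
  refine squeeze_zero (fun _ => norm_nonneg _) (fun a => ?_) h
  have h1 := (Matrix.toEuclideanCLM (𝕜 := ℝ) (A a - B)).le_opNorm (EuclideanSpace.single j 1)
  have h2 := PiLp.norm_apply_le
    (Matrix.toEuclideanCLM (𝕜 := ℝ) (A a - B) (EuclideanSpace.single j 1)) i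
  rw [PiLp.norm_single, norm_one, mul_one] at h1
  simpa [l2OpNorm, Matrix.ofLp_toEuclideanCLM] using h2.trans h1

/-- If `u` spans the eigenspace of the top eigenvalue `a`, in the sense that every eigenvalue with
an eigenvector orthogonal to `u` is at most `b < a`, then any unit eigenvector whose eigenvalue is
at least `a` is `u` or `-u`. -/
theorem Matrix.exists_eq_smul_of_simple_top_eigenvalue {ι : Type*} [Fintype ι]
    {A : Matrix ι ι ℝ} {a b t : ℝ} (hab : b < a) {u v : ι → ℝ} (hu : u ⬝ᵥ u = 1)
    (hAu : A.mulVec u = a • u)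
    (hmax : ∀ (ν : ℝ) (x : ι → ℝ), x ≠ 0 → A.mulVec x = ν • x → ν ≤ a)
    (hsec : ∀ (ν : ℝ) (x : ι → ℝ), x ≠ 0 → A.mulVec x = ν • x → x ⬝ᵥ u = 0 → ν ≤ b)
    (hv : v ⬝ᵥ v = 1) (hAv : A.mulVec v = t • v) (ht : a ≤ t) :
    ∃ c : ℝ, (c = 1 ∨ c = -1) ∧ v = c • u := by
  have hv0 : v ≠ 0 := by
    rintro rfl
    simp at hv
  obtain rfl : t = a := le_antisymm (hmax t v hv0 hAv) ht
  have hvu : v = (v ⬝ᵥ u) • u := by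
    by_contra hne
    refine (hsec t (v - (v ⬝ᵥ u) • u) (sub_ne_zero.2 hne) ?_ ?_).not_gt hab
    · rw [Matrix.mulVec_sub, Matrix.mulVec_smul, hAv, hAu, smul_sub, smul_comm]
    · rw [sub_dotProduct, smul_dotProduct, hu, smul_eq_mul, mul_one, sub_self]
  refine ⟨v ⬝ᵥ u, ?_, hvu⟩
  rw [hvu, smul_dotProduct, dotProduct_smul, hu, smul_eq_mul, smul_eq_mul, mul_one] at hv
  exact mul_self_eq_one_iff.1 hv

/-- Sign correction recovers a positive vector from limits of `u` or `-u`. -/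
theorem tendsto_sign_sum_smul {ι α : Type*} [Fintype ι] [Nonempty ι] {l : Filter α}
    {v : α → ι → ℝ} {u : ι → ℝ} (hu : ∀ i, 0 < u i) {c : ℝ} (hc : c = 1 ∨ c = -1)
    (hv : Tendsto v l (𝓝 (c • u))) :
    Tendsto (fun a => Real.sign (∑ i, v a i) • v a) l (𝓝 u) := by
  have hpos : 0 < ∑ i, u i := Finset.sum_pos (fun i _ => hu i) Finset.univ_nonempty
  have hsum : Tendsto (fun a => ∑ i, v a i) l (𝓝 (c * ∑ i, u i)) := by
    rw [Finset.mul_sum]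
    exact tendsto_finsetSum _ fun i _ => tendsto_pi_nhds.1 hv i
  have hsign : ∀ᶠ a in l, Real.sign (∑ i, v a i) = c := by
    rcases hc with rfl | rfl
    · filter_upwards [hsum.eventually_const_lt (u := 0) (by simpa using hpos)] with a ha
      exact Real.sign_of_pos ha
    · filter_upwards [hsum.eventually_lt_const (u := 0) (by simpa using hpos)] with a ha
      exact Real.sign_of_neg ha
  have hcu : c • c • u = u := by
    rcases hc with rfl | rfl <;> simp
  rw [← hcu]
  refine (hv.const_smul c).congr' ?_
  filter_upwards [hsign] with a ha
  rw [ha]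

/-- deterministic core of Theorem 1. If symmetric matrices `Ĉ_m` converge to
`C` in spectral norm, where `C` has a simple largest eigenvalue `lam1 > lam2` with positive unit
eigenvector `u`, then the sign-corrected leading unit eigenvectors `û_m` of `Ĉ_m` eventually
order any pair `i, j` with `u i < u j` correctly. -/
theorem blind_ranking_consistent_deterministic
    {n : ℕ} (C : Matrix (Fin n) (Fin n) ℝ) (hC : C.IsSymm)
    (lam1 lam2 : ℝ) (hgap : lam2 < lam1)
    (u : Fin n → ℝ) (hu_unit : ∑ i, u i ^ 2 = 1) (hu_pos : ∀ i, 0 < u i)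
    (hu_eig : C.mulVec u = lam1 • u)
    (hmax : ∀ (ν : ℝ) (x : Fin n → ℝ), x ≠ 0 → C.mulVec x = ν • x → ν ≤ lam1)
    (hsec : ∀ (ν : ℝ) (x : Fin n → ℝ), x ≠ 0 → C.mulVec x = ν • x →
      (∑ i, x i * u i) = 0 → ν ≤ lam2)
    (Chat : ℕ → Matrix (Fin n) (Fin n) ℝ) (hChat_symm : ∀ m, (Chat m).IsSymm)
    (hconv : Tendsto (fun m => l2OpNorm (Chat m - C)) atTop (𝓝 0))
    (vhat : ℕ → Fin n → ℝ)
    (hvhat_unit : ∀ m, ∑ i, vhat m i ^ 2 = 1)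
    (hvhat_eig : ∀ m, ∃ t : ℝ, (Chat m).mulVec (vhat m) = t • vhat m ∧
      ∀ (ν : ℝ) (x : Fin n → ℝ), x ≠ 0 → (Chat m).mulVec x = ν • x → ν ≤ t)
    (uhat : ℕ → Fin n → ℝ)
    (huhat : ∀ m, uhat m = Real.sign (∑ i, vhat m i) • vhat m) :
    ∀ i j, u i < u j → ∃ M, ∀ m ≥ M, uhat m i < uhat m j := by
  intro i j hij
  by_contra! hbad
  have : Nonempty (Fin n) := ⟨i⟩
  have hself : ∀ x : Fin n → ℝ, x ⬝ᵥ x = ∑ k, x k ^ 2 := fun x =>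
    Finset.sum_congr rfl fun k _ => (sq (x k)).symm
  have hu : u ⬝ᵥ u = 1 := (hself u).trans hu_unit
  have hvhat : ∀ m, vhat m ⬝ᵥ vhat m = 1 := fun m => (hself _).trans (hvhat_unit m)
  have hfreq : ∃ᶠ m in atTop, uhat m j ≤ uhat m i := frequently_atTop.2 hbad
  obtain ⟨ψ, hψ, hψbad⟩ := extraction_of_frequently_atTop hfreq
  have hmem : ∀ m, vhat (ψ m) ∈ Set.Icc (-1 : Fin n → ℝ) 1 := fun m => by
    have hk : ∀ k, |vhat (ψ m) k| ≤ 1 := fun k => by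
      rw [← sq_le_one_iff_abs_le_one, ← hvhat_unit (ψ m)]
      exact Finset.single_le_sum (f := fun k => vhat (ψ m) k ^ 2)
        (fun k _ => sq_nonneg _) (Finset.mem_univ k)
    exact ⟨fun k => (abs_le.1 (hk k)).1, fun k => (abs_le.1 (hk k)).2⟩
  obtain ⟨v, -, φ, hφ, hv⟩ := isCompact_Icc.tendsto_subseq hmem
  have hA : Tendsto (fun m => Chat (ψ (φ m))) atTop (𝓝 C) :=
    (tendsto_of_tendsto_l2OpNorm_sub hconv).comp (hψ.comp hφ).tendsto_atTop
  replace hv : Tendsto (fun m => vhat (ψ (φ m))) atTop (𝓝 v) := hv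
  have hmulVec : Continuous fun p : Matrix (Fin n) (Fin n) ℝ × (Fin n → ℝ) => p.1.mulVec p.2 :=
    continuous_fst.matrix_mulVec continuous_snd
  have hdot : Continuous fun p : (Fin n → ℝ) × (Fin n → ℝ) => p.1 ⬝ᵥ p.2 :=
    continuous_fst.dotProduct continuous_snd
  have hAv : Tendsto (fun m => (Chat (ψ (φ m))).mulVec (vhat (ψ (φ m)))) atTop
      (𝓝 (C.mulVec v)) := (hmulVec.tendsto (C, v)).comp (hA.prodMk_nhds hv)
  have hAu : Tendsto (fun m => (Chat (ψ (φ m))).mulVec u) atTop (𝓝 (C.mulVec u)) :=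
    (hmulVec.tendsto (C, u)).comp (hA.prodMk_nhds tendsto_const_nhds)
  have hvv : v ⬝ᵥ v = 1 :=
    tendsto_nhds_unique (((hdot.tendsto (v, v)).comp (hv.prodMk_nhds hv)).congr
      fun m => hvhat (ψ (φ m))) tendsto_const_nhds
  choose t ht htmax using hvhat_eig
  have htlim : Tendsto (fun m => t (ψ (φ m))) atTop (𝓝 (v ⬝ᵥ C.mulVec v)) := by
    refine ((hdot.tendsto (v, C.mulVec v)).comp (hv.prodMk_nhds hAv)).congr fun m => ?_
    simp [ht, dotProduct_smul, hvhat]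
  have heig : C.mulVec v = (v ⬝ᵥ C.mulVec v) • v :=
    tendsto_nhds_unique hAv ((htlim.smul hv).congr fun m => (ht _).symm)
  have hle : lam1 ≤ v ⬝ᵥ C.mulVec v := by
    have hlim := (hdot.tendsto (u, C.mulVec u)).comp (tendsto_const_nhds.prodMk_nhds hAu)
    have h := le_of_tendsto_of_tendsto' hlim htlim fun m => by
      simpa [hu] using (hChat_symm (ψ (φ m))).dotProduct_mulVec_le_of_forall_eigenvalue_le
        (htmax _) u
    simpa [hu_eig, dotProduct_smul, hu] using h
  obtain ⟨c, hc, rfl⟩ := Matrix.exists_eq_smul_of_simple_top_eigenvalue hgap hu hu_eig hmax hsec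
    hvv heig hle
  have hlim : Tendsto (fun m => uhat (ψ (φ m))) atTop (𝓝 u) := by
    simpa only [huhat] using tendsto_sign_sum_smul hu_pos hc hv
  exact hij.not_ge (le_of_tendsto_of_tendsto' (tendsto_pi_nhds.1 hlim j)
    (tendsto_pi_nhds.1 hlim i) fun m => hψbad (φ m))
end

section
/- (Sign-correction lemma.) Let u, û ∈ ℝⁿ be unit vectors with u entrywise nonnegative, and suppose |⟨u, û⟩| > √(1 − ⟨u, 1/√n⟩²), where 1/√n denotes the normalized all-ones vector. Then ⟨û, 1⟩ ≠ 0 and sgn(⟨û, 1⟩) · ⟨u, û⟩ > 0; that is, the sign-corrected vector sgn(⟨û, 1⟩) · û has positive inner product with u. -/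
/-- The Gram determinant of three unit vectors is nonnegative. -/
theorem gram_three_unit_nonneg {ι : Type*} [Fintype ι] (u v e : ι → ℝ)
    (hu : ∑ i, u i ^ 2 = 1) (hv : ∑ i, v i ^ 2 = 1) (he : ∑ i, e i ^ 2 = 1) :
    0 ≤ 1 - (∑ i, u i * e i) ^ 2 - (∑ i, u i * v i) ^ 2 - (∑ i, v i * e i) ^ 2
      + 2 * (∑ i, u i * e i) * (∑ i, u i * v i) * (∑ i, v i * e i) := by
  have expand (a b : ℝ) (x y : ι → ℝ) : ∑ i, (x i - a * u i) * (y i - b * u i)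
      = ∑ i, x i * y i - b * ∑ i, u i * x i - a * ∑ i, u i * y i + a * b := by
    have huu : a * b = a * b * ∑ i, u i ^ 2 := by rw [hu, mul_one]
    rw [huu]
    simp only [Finset.mul_sum, ← Finset.sum_sub_distrib, ← Finset.sum_add_distrib]
    exact Finset.sum_congr rfl fun i _ => by ring
  have key := Finset.sum_mul_sq_le_sq_mul_sq Finset.univ
    (fun i => v i - (∑ j, u j * v j) * u i) (fun i => e i - (∑ j, u j * e j) * u i)
  simp only [pow_two (_ - _ : ℝ), expand] at key
  simp only [← pow_two, hv, he] at key
  nlinarith [key]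

/-- sign-correction lemma. For unit vectors `u, û` with `u` entrywise
nonnegative, if `|⟨u, û⟩| > √(1 − ⟨u, 1/√n⟩²)` then `⟨û, 1⟩ ≠ 0` and the sign-corrected
vector `sgn(⟨û, 1⟩) · û` has positive inner product with `u`. -/
theorem sign_correction
    {n : ℕ} (u uhat : Fin n → ℝ)
    (hu_unit : ∑ i, u i ^ 2 = 1) (huhat_unit : ∑ i, uhat i ^ 2 = 1)
    (hu_nonneg : ∀ i, 0 ≤ u i)
    (h : Real.sqrt (1 - (∑ i, u i * (1 / Real.sqrt (n : ℝ))) ^ 2) < |∑ i, u i * uhat i|) :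
    (∑ i, uhat i) ≠ 0 ∧ 0 < Real.sign (∑ i, uhat i) * (∑ i, u i * uhat i) := by
  have hn : (0 : ℝ) < n := by
    rcases Nat.eq_zero_or_pos n with rfl | hn
    · simp at hu_unit
    · exact_mod_cast hn
  have hs : 0 < 1 / Real.sqrt (n : ℝ) := by positivity
  have he : ∑ _i : Fin n, (1 / Real.sqrt (n : ℝ)) ^ 2 = 1 := by
    simp [Real.sq_sqrt hn.le, hn.ne']
  have hgram := gram_three_unit_nonneg u uhat (fun _ => 1 / Real.sqrt (n : ℝ))
    hu_unit huhat_unit he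
  have hb := Real.lt_sq_of_sqrt_lt h
  rw [sq_abs] at hb
  have ha : 0 ≤ ∑ i, u i * (1 / Real.sqrt (n : ℝ)) :=
    Finset.sum_nonneg fun i _ => mul_nonneg (hu_nonneg i) hs.le
  rw [← Finset.sum_mul Finset.univ uhat] at hgram
  set a := ∑ i, u i * (1 / Real.sqrt (n : ℝ))
  set b := ∑ i, u i * uhat i
  set S := ∑ i, uhat i
  set s := 1 / Real.sqrt (n : ℝ)
  have hprod : 0 < (a * s) * (S * b) := by nlinarith [sq_nonneg (S * s)]
  have hSb : 0 < S * b := pos_of_mul_pos_right hprod (mul_nonneg ha hs.le)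
  rcases mul_pos_iff.mp hSb with ⟨hS, hb⟩ | ⟨hS, hb⟩
  · exact ⟨hS.ne', by rwa [Real.sign_of_pos hS, one_mul]⟩
  · exact ⟨hS.ne, by rw [Real.sign_of_neg hS]; linarith⟩
end

section
/- (Solution of the worst-case perturbation program, lower bound.) Let u ∈ ℝⁿ be a unit vector, let i ≠ j be indices, and let ε ∈ ℝⁿ satisfy ⟨ε, u⟩ = 0. Then ε_j − ε_i ≥ −‖ε‖₂ · √(2 − (u_i − u_j)²). (Note that (u_i − u_j)² ≤ 2 since ‖u‖₂ = 1, so the square root is well defined.) -/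
/-- worst-case perturbation program, lower bound. For a unit vector `u`,
indices `i ≠ j`, and `ε ⊥ u`, we have `ε_j − ε_i ≥ −‖ε‖₂ √(2 − (u_i − u_j)²)`. -/
theorem perturbation_lower_bound
    {n : ℕ} (u ε : Fin n → ℝ) (hu_unit : ∑ k, u k ^ 2 = 1)
    (i j : Fin n) (hij : i ≠ j)
    (horth : ∑ k, ε k * u k = 0) :
    -(Real.sqrt (∑ k, ε k ^ 2) * Real.sqrt (2 - (u i - u j) ^ 2)) ≤ ε j - ε i := by
  set c := u i - u j with hc
  let v : Fin n → ℝ := fun k => (if k = i then 1 else 0) - (if k = j then 1 else 0) - c * u k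
  have inner_eq : ∑ k, ε k * v k = ε i - ε j := by
    calc ∑ k, ε k * v k
        = ∑ k, ((if k = i then ε k else 0) - (if k = j then ε k else 0) - c * (ε k * u k)) := by
          refine Finset.sum_congr rfl fun k _ => ?_
          simp only [v]
          split_ifs <;> ring
      _ = ε i - ε j := by
          simp [Finset.sum_sub_distrib, ← Finset.mul_sum, horth]
  have norm_sq_eq : ∑ k, v k ^ 2 = 2 - c ^ 2 := by
    calc ∑ k, v k ^ 2
        = ∑ k, ((if k = i then 1 - 2 * c * u k else 0)
            + (if k = j then 1 + 2 * c * u k else 0) + c ^ 2 * u k ^ 2) := by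
          refine Finset.sum_congr rfl fun k _ => ?_
          simp only [v]
          split_ifs with hi hj
          · exact absurd (hi.symm.trans hj) hij
          all_goals ring
      _ = (1 - 2 * c * u i) + (1 + 2 * c * u j) + c ^ 2 := by
          simp [Finset.sum_add_distrib, ← Finset.mul_sum, hu_unit]
      _ = 2 - c ^ 2 := by rw [hc]; ring
  have cauchy_schwarz := Real.sum_mul_le_sqrt_mul_sqrt Finset.univ ε v
  rw [inner_eq, norm_sq_eq] at cauchy_schwarz
  linarith
end

section
/- (The worst-case perturbation attains the lower bound.) Let u ∈ ℝⁿ be a unit vector, let i ≠ j be indices with d = u_j − u_i satisfying d² < 2, and let β ≥ 0. Define ε₀ = √(β²/(2 − d²)) · (e_i − e_j + d·u), where e_i, e_j are standard basis vectors. Then ⟨ε₀, u⟩ = 0, ‖ε₀‖₂ = β, and (ε₀)_j − (ε₀)_i = −β · √(2 − d²). -/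
theorem sum_single_sub_single_add_smul_mul {ι R : Type*} [Fintype ι] [DecidableEq ι] [CommRing R]
    (i j : ι) (d : R) (u w : ι → R) :
    ∑ k, (Pi.single i (1 : R) - Pi.single j (1 : R) + d • u : ι → R) k * w k =
      w i - w j + d * ∑ k, u k * w k := by
  simp [add_mul, sub_mul, Finset.sum_add_distrib, Finset.sum_sub_distrib, Pi.single_apply,
    Finset.mul_sum, mul_assoc]

/-- the worst-case perturbation attains the lower bound. For a unit vector
`u`, indices `i ≠ j` with `d = u_j − u_i`, `d² < 2`, and `β ≥ 0`, the vector
`ε₀ = √(β²/(2 − d²)) (e_i − e_j + d u)` is orthogonal to `u`, has norm `β`, and satisfies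
`(ε₀)_j − (ε₀)_i = −β √(2 − d²)`. -/
theorem worst_case_perturbation_attained
    {n : ℕ} (u : Fin n → ℝ) (hu_unit : ∑ k, u k ^ 2 = 1)
    (i j : Fin n) (hij : i ≠ j)
    (d : ℝ) (hd : d = u j - u i) (hd2 : d ^ 2 < 2)
    (β : ℝ) (hβ : 0 ≤ β)
    (ε₀ : Fin n → ℝ)
    (hε₀ : ε₀ = Real.sqrt (β ^ 2 / (2 - d ^ 2)) •
      (Pi.single i (1 : ℝ) - Pi.single j (1 : ℝ) + d • u)) :
    (∑ k, ε₀ k * u k = 0) ∧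
    Real.sqrt (∑ k, ε₀ k ^ 2) = β ∧
    ε₀ j - ε₀ i = -(β * Real.sqrt (2 - d ^ 2)) := by
  have hpos : 0 < 2 - d ^ 2 := by linarith
  have hr : 0 < Real.sqrt (2 - d ^ 2) := Real.sqrt_pos.2 hpos
  have hr2 : Real.sqrt (2 - d ^ 2) ^ 2 = 2 - d ^ 2 := Real.sq_sqrt hpos.le
  rw [Real.sqrt_div (sq_nonneg β), Real.sqrt_sq hβ] at hε₀
  set r := Real.sqrt (2 - d ^ 2)
  set v : Fin n → ℝ := Pi.single i (1 : ℝ) - Pi.single j (1 : ℝ) + d • u with hv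
  have hvi : v i = 1 + d * u i := by simp [hv, hij]
  have hvj : v j = -1 + d * u j := by simp [hv, hij.symm]
  have hvu : ∑ k, v k * u k = 0 := by
    rw [hv, sum_single_sub_single_add_smul_mul]
    simp only [← sq, hu_unit]
    linarith
  have hvv : ∑ k, v k * v k = r ^ 2 := by
    have h := sum_single_sub_single_add_smul_mul i j d u v
    rw [← hv, hvi, hvj] at h
    simp only [mul_comm (u _) (v _), hvu] at h
    rw [h, hr2, hd]
    ring
  subst hε₀
  refine ⟨?_, ?_, ?_⟩
  · simp only [Pi.smul_apply, smul_eq_mul, mul_assoc, ← Finset.mul_sum, hvu, mul_zero]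
  · simp only [Pi.smul_apply, smul_eq_mul, mul_pow, ← Finset.mul_sum]
    simp only [sq (v _), hvv]
    rw [← mul_pow, div_mul_cancel₀ _ hr.ne', Real.sqrt_sq hβ]
  · have hdiff : v j - v i = -(r ^ 2) := by
      rw [hvi, hvj, hr2, hd]
      ring
    simp only [Pi.smul_apply, smul_eq_mul, ← mul_sub, hdiff]
    field_simp
end

section
/- (Pairwise ordering condition.) Let u, û ∈ ℝⁿ be unit vectors with α = ⟨u, û⟩ > 0, and write û = α·u + ε where ⟨ε, u⟩ = 0. Let i, j be indices with u_j > u_i. If α²(u_j − u_i)² > (1 − α²)(2 − (u_j − u_i)²), then û_j > û_i. -/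
/-- A vector `ε` orthogonal to the unit vector `u` only sees the part of `e_j - e_i` orthogonal
to `u`, so Cauchy-Schwarz bounds the difference of its coordinates. -/
theorem sq_coord_sub_le_of_orthogonal {ι : Type*} [Fintype ι] (u ε : ι → ℝ)
    (hu : ∑ k, u k ^ 2 = 1) (horth : ∑ k, ε k * u k = 0) {i j : ι} (hij : i ≠ j) :
    (ε j - ε i) ^ 2 ≤ (2 - (u j - u i) ^ 2) * ∑ k, ε k ^ 2 := by
  classical
  set v : ι → ℝ := Pi.single j 1 - Pi.single i 1 with hv
  have hdot (f : ι → ℝ) : ∑ k, v k * f k = f j - f i := by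
    simp [hv, sub_mul, Finset.sum_sub_distrib, Pi.single_apply]
  have hvv : ∑ k, v k * v k = 2 := by
    rw [hdot]
    simp [hv, hij, hij.symm]
    norm_num
  have hcs := Finset.sum_mul_sq_le_sq_mul_sq Finset.univ (fun k => v k - (u j - u i) * u k) ε
  have hinner : ∑ k, (v k - (u j - u i) * u k) * ε k = ε j - ε i := by
    calc ∑ k, (v k - (u j - u i) * u k) * ε k
        = ∑ k, v k * ε k - (u j - u i) * ∑ k, ε k * u k := by
          rw [Finset.mul_sum, ← Finset.sum_sub_distrib]
          exact Finset.sum_congr rfl fun k _ => by ring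
      _ = ε j - ε i := by rw [hdot, horth]; ring
  have hnorm : ∑ k, (v k - (u j - u i) * u k) ^ 2 = 2 - (u j - u i) ^ 2 := by
    calc ∑ k, (v k - (u j - u i) * u k) ^ 2
        = ∑ k, v k * v k - 2 * (u j - u i) * ∑ k, v k * u k
            + (u j - u i) ^ 2 * ∑ k, u k ^ 2 := by
          rw [Finset.mul_sum, Finset.mul_sum, ← Finset.sum_sub_distrib, ← Finset.sum_add_distrib]
          exact Finset.sum_congr rfl fun k _ => by ring
      _ = 2 - (u j - u i) ^ 2 := by rw [hvv, hdot, hu]; ring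
  rwa [hinner, hnorm] at hcs

/-- pairwise ordering condition. For unit vectors `u, û` with
`α = ⟨u, û⟩ > 0` and `û = α u + ε`, `ε ⊥ u`, if `α²(u_j − u_i)² > (1 − α²)(2 − (u_j − u_i)²)`
for indices `i, j` with `u_j > u_i`, then `û_j > û_i`. -/
theorem pairwise_ordering_condition
    {n : ℕ} (u uhat ε : Fin n → ℝ)
    (hu_unit : ∑ k, u k ^ 2 = 1) (huhat_unit : ∑ k, uhat k ^ 2 = 1)
    (α : ℝ) (hα : α = ∑ k, u k * uhat k) (hαpos : 0 < α)
    (hdecomp : uhat = α • u + ε) (horth : ∑ k, ε k * u k = 0)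
    (i j : Fin n) (hij : u i < u j)
    (hcond : α ^ 2 * (u j - u i) ^ 2 > (1 - α ^ 2) * (2 - (u j - u i) ^ 2)) :
    uhat i < uhat j := by
  have hne : i ≠ j := fun h => hij.ne (congrArg u h)
  have hε : ∑ k, ε k ^ 2 = 1 - α ^ 2 := by
    have hexpand : ∑ k, uhat k ^ 2
        = α ^ 2 * ∑ k, u k ^ 2 + 2 * α * ∑ k, ε k * u k + ∑ k, ε k ^ 2 := by
      rw [Finset.mul_sum, Finset.mul_sum, ← Finset.sum_add_distrib, ← Finset.sum_add_distrib]
      refine Finset.sum_congr rfl fun k _ => ?_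
      rw [hdecomp, Pi.add_apply, Pi.smul_apply, smul_eq_mul]
      ring
    rw [huhat_unit, hu_unit, horth] at hexpand
    linarith
  have hbound := sq_coord_sub_le_of_orthogonal u ε hu_unit horth hne
  rw [hε] at hbound
  have hlt : (ε j - ε i) ^ 2 < (α * (u j - u i)) ^ 2 := by
    rw [mul_pow]
    linarith
  have habs := abs_lt_of_sq_lt_sq hlt (mul_pos hαpos (sub_pos.mpr hij)).le
  have hlower := (abs_lt.mp habs).1
  rw [hdecomp]
  simp only [Pi.add_apply, Pi.smul_apply, smul_eq_mul]
  linarith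
end

section
/- (Theorem 2, deterministic angle form.) Let u, û ∈ ℝⁿ be unit vectors with u entrywise nonnegative, and let i, j be indices with u_i < u_j. If sin²θ(u, û) < min( (u_j − u_i)²/2 , ⟨u, 1/√n⟩² ), where 1/√n is the normalized all-ones vector, then the sign-corrected vector û' = sgn(⟨û, 1⟩) · û satisfies û'_i < û'_j. -/
/-- The Gram determinant of two unit vectors `u`, `v` and a third vector `d` is nonnegative. -/
theorem gram_det_nonneg_of_unit {ι : Type*} [Fintype ι] (u v d : ι → ℝ)
    (hu : ∑ k, u k ^ 2 = 1) (hv : ∑ k, v k ^ 2 = 1) :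
    0 ≤ (∑ k, d k ^ 2) * (1 - (∑ k, u k * v k) ^ 2) - (∑ k, u k * d k) ^ 2
      + 2 * (∑ k, u k * d k) * (∑ k, v k * d k) * (∑ k, u k * v k) - (∑ k, v k * d k) ^ 2 := by
  set c := ∑ k, u k * v k with hc
  set a := ∑ k, u k * d k with ha
  set b := ∑ k, v k * d k with hb
  set D := ∑ k, d k ^ 2 with hD
  have hcs := Finset.sum_mul_sq_le_sq_mul_sq Finset.univ
    (fun k => v k - c * u k) (fun k => d k - a * u k)
  have hvd : ∑ k, (v k - c * u k) * (d k - a * u k) = b - a * c := by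
    calc ∑ k, (v k - c * u k) * (d k - a * u k)
        = ∑ k, (v k * d k - a * (u k * v k) - c * (u k * d k) + c * a * u k ^ 2) :=
          Finset.sum_congr rfl fun k _ => by ring
      _ = b - a * c := by
          rw [Finset.sum_add_distrib, Finset.sum_sub_distrib, Finset.sum_sub_distrib,
            ← Finset.mul_sum, ← Finset.mul_sum, ← Finset.mul_sum, hu, ← hc, ← ha, ← hb]
          ring
  have hvv : ∑ k, (v k - c * u k) ^ 2 = 1 - c ^ 2 := by
    calc ∑ k, (v k - c * u k) ^ 2
        = ∑ k, (v k ^ 2 - 2 * c * (u k * v k) + c ^ 2 * u k ^ 2) :=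
          Finset.sum_congr rfl fun k _ => by ring
      _ = 1 - c ^ 2 := by
          rw [Finset.sum_add_distrib, Finset.sum_sub_distrib,
            ← Finset.mul_sum, ← Finset.mul_sum, hu, hv, ← hc]
          ring
  have hdd : ∑ k, (d k - a * u k) ^ 2 = D - a ^ 2 := by
    calc ∑ k, (d k - a * u k) ^ 2
        = ∑ k, (d k ^ 2 - 2 * a * (u k * d k) + a ^ 2 * u k ^ 2) :=
          Finset.sum_congr rfl fun k _ => by ring
      _ = D - a ^ 2 := by
          rw [Finset.sum_add_distrib, Finset.sum_sub_distrib,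
            ← Finset.mul_sum, ← Finset.mul_sum, hu, ← ha, ← hD]
          ring
  rw [hvd, hvv, hdd] at hcs
  linarith

/-- If the angle between the unit vectors `u` and `v` is smaller than the angle between `u` and
the hyperplane orthogonal to `d`, and `⟨u, d⟩ > 0`, then `⟨v, d⟩` has the sign of `⟨u, v⟩`. -/
theorem inner_mul_inner_pos_of_sin_sq_lt {ι : Type*} [Fintype ι] (u v d : ι → ℝ)
    (hu : ∑ k, u k ^ 2 = 1) (hv : ∑ k, v k ^ 2 = 1) (hud : 0 < ∑ k, u k * d k)
    (h : (∑ k, d k ^ 2) * (1 - (∑ k, u k * v k) ^ 2) < (∑ k, u k * d k) ^ 2) :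
    0 < (∑ k, u k * v k) * ∑ k, v k * d k := by
  have hgram := gram_det_nonneg_of_unit u v d hu hv
  refine pos_of_mul_pos_right (a := ∑ k, u k * d k) ?_ hud.le
  nlinarith [sq_nonneg (∑ k, v k * d k)]


/-- Theorem 2, deterministic angle form. For unit vectors `u, û` with `u`
entrywise nonnegative and indices `i, j` with `u_i < u_j`, if
`sin²θ(u, û) < min((u_j − u_i)²/2, ⟨u, 1/√n⟩²)` then the sign-corrected vector
`û' = sgn(⟨û, 1⟩) û` satisfies `û'_i < û'_j`. -/
theorem pairwise_ordering_angle_form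
    {n : ℕ} (u uhat : Fin n → ℝ)
    (hu_unit : ∑ k, u k ^ 2 = 1) (huhat_unit : ∑ k, uhat k ^ 2 = 1)
    (hu_nonneg : ∀ k, 0 ≤ u k)
    (i j : Fin n) (hij : u i < u j)
    (hsin : 1 - (∑ k, u k * uhat k) ^ 2 <
      min ((u j - u i) ^ 2 / 2) ((∑ k, u k * (1 / Real.sqrt (n : ℝ))) ^ 2)) :
    (Real.sign (∑ k, uhat k) • uhat) i < (Real.sign (∑ k, uhat k) • uhat) j := by
  obtain ⟨hdiff, hones⟩ := lt_min_iff.mp hsin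
  have hn : (0 : ℝ) < n := by exact_mod_cast i.pos
  have hne : i ≠ j := by
    rintro rfl
    exact lt_irrefl _ hij
  have hsum : 0 < ∑ k, u k :=
    Finset.sum_pos' (fun k _ => hu_nonneg k) ⟨j, Finset.mem_univ j, (hu_nonneg i).trans_lt hij⟩
  have hsign : 0 < (∑ k, u k * uhat k) * ∑ k, uhat k := by
    have key := inner_mul_inner_pos_of_sin_sq_lt u uhat (fun _ => 1) hu_unit huhat_unit
    simp only [mul_one, one_pow, Finset.sum_const, Finset.card_univ, Fintype.card_fin,
      nsmul_eq_mul] at key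
    refine key hsum ?_
    rw [← Finset.sum_mul, mul_pow, div_pow, one_pow, Real.sq_sqrt hn.le, mul_one_div,
      lt_div_iff₀ hn] at hones
    linarith
  have horder : 0 < (∑ k, u k * uhat k) * (uhat j - uhat i) := by
    have hinner (w : Fin n → ℝ) :
        ∑ k, w k * (Pi.single j 1 - Pi.single i 1 : Fin n → ℝ) k = w j - w i := by
      simp [mul_sub, Finset.sum_sub_distrib, Pi.single_apply]
    have hnorm : ∑ k, (Pi.single j 1 - Pi.single i 1 : Fin n → ℝ) k ^ 2 = 2 := by
      simp only [sq, hinner]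
      simp [hne, hne.symm]
      norm_num
    have key := inner_mul_inner_pos_of_sin_sq_lt u uhat (Pi.single j 1 - Pi.single i 1)
      hu_unit huhat_unit
    rw [hinner, hinner, hnorm] at key
    exact key (sub_pos.mpr hij) (by linarith)
  simp only [Pi.smul_apply, smul_eq_mul]
  rcases pos_and_pos_or_neg_and_neg_of_mul_pos hsign with ⟨hc, hs⟩ | ⟨hc, hs⟩
  · rw [Real.sign_of_pos hs]
    linarith [pos_of_mul_pos_right horder hc.le]
  · rw [Real.sign_of_neg hs]
    linarith [neg_of_mul_pos_right horder hc.le]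
end

section
/- (Theorem 2, matrix perturbation form.) Let C and Ĉ be real symmetric n×n matrices; let λ₁ ≥ λ₂ be the two largest eigenvalues of C with eigengap δ = λ₁ − λ₂ > 0, and let u be a unit eigenvector of C associated with λ₁ having entrywise nonnegative entries. Let i, j be indices with u_i < u_j. If ‖Ĉ − C‖₂ < (δ/2) · min( (u_j − u_i)/√2 , ⟨u, 1/√n⟩ ), then for every unit eigenvector v̂ of Ĉ associated with its largest eigenvalue, the sign-corrected vector û = sgn(⟨v̂, 1⟩) · v̂ satisfies û_i < û_j. -/
open Matrix in
/-- A symmetric matrix all of whose eigenvalues are at most `m` has quadratic form at most `m`. -/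
theorem Matrix.IsSymm.dotProduct_mulVec_le_of_eigenvalue_le {n : ℕ}
    {A : Matrix (Fin n) (Fin n) ℝ} (hA : A.IsSymm) {m : ℝ}
    (h : ∀ (ν : ℝ) (x : Fin n → ℝ), x ≠ 0 → A *ᵥ x = ν • x → ν ≤ m) (x : Fin n → ℝ) :
    x ⬝ᵥ A *ᵥ x ≤ m * (x ⬝ᵥ x) := by
  have hB : (m • (1 : Matrix (Fin n) (Fin n) ℝ) - A).IsHermitian := by
    rw [Matrix.IsHermitian, conjTranspose_eq_transpose_of_trivial]
    simp [hA.eq]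
  have hpsd : (m • (1 : Matrix (Fin n) (Fin n) ℝ) - A).PosSemidef := by
    rw [hB.posSemidef_iff_eigenvalues_nonneg]
    intro k
    have hk := hB.mulVec_eigenvectorBasis k
    have hne : ((hB.eigenvectorBasis k : EuclideanSpace ℝ (Fin n)) : Fin n → ℝ) ≠ 0 := by
      intro h0
      apply hB.eigenvectorBasis.orthonormal.ne_zero k
      ext l
      exact congrFun h0 l
    have := h (m - hB.eigenvalues k) _ hne (by
      rw [sub_mulVec, smul_mulVec, one_mulVec] at hk
      rw [sub_smul, ← hk]
      abel)
    simpa using this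
  have := hpsd.dotProduct_mulVec_nonneg x
  simp only [star_trivial, sub_mulVec, smul_mulVec, one_mulVec, dotProduct_sub,
    dotProduct_smul, smul_eq_mul] at this
  linarith

open Matrix in
theorem sq_dotProduct_mulVec_le_l2OpNorm {n : ℕ} (E : Matrix (Fin n) (Fin n) ℝ)
    (x y : Fin n → ℝ) :
    (x ⬝ᵥ E *ᵥ y) ^ 2 ≤ l2OpNorm E ^ 2 * ((x ⬝ᵥ x) * (y ⬝ᵥ y)) := by
  have hn (z : Fin n → ℝ) : ‖WithLp.toLp 2 z‖ ^ 2 = z ⬝ᵥ z := by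
    rw [EuclideanSpace.real_norm_sq_eq]
    simp [dotProduct, sq]
  have hi : inner ℝ (WithLp.toLp 2 x) (toEuclideanCLM (𝕜 := ℝ) E (WithLp.toLp 2 y))
      = x ⬝ᵥ E *ᵥ y := by
    rw [toEuclideanCLM_toLp, EuclideanSpace.inner_toLp_toLp, star_trivial, dotProduct_comm]
  have h : |x ⬝ᵥ E *ᵥ y| ≤ l2OpNorm E * (‖WithLp.toLp 2 x‖ * ‖WithLp.toLp 2 y‖) := by
    rw [← hi]
    calc _ ≤ ‖WithLp.toLp 2 x‖ * ‖toEuclideanCLM (𝕜 := ℝ) E (WithLp.toLp 2 y)‖ :=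
          abs_real_inner_le_norm _ _
      _ ≤ ‖WithLp.toLp 2 x‖ * (l2OpNorm E * ‖WithLp.toLp 2 y‖) := by
          gcongr
          exact (toEuclideanCLM (𝕜 := ℝ) E).le_opNorm _
      _ = _ := by ring
  calc (x ⬝ᵥ E *ᵥ y) ^ 2 = |x ⬝ᵥ E *ᵥ y| ^ 2 := (sq_abs _).symm
    _ ≤ (l2OpNorm E * (‖WithLp.toLp 2 x‖ * ‖WithLp.toLp 2 y‖)) ^ 2 := by gcongr
    _ = _ := by rw [mul_pow, mul_pow, hn, hn]

open Matrix in
/-- On the orthogonal complement of a unit eigenvector `u`, the quadratic form of a symmetric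
matrix is bounded by the largest eigenvalue having an eigenvector orthogonal to `u`. -/
theorem Matrix.IsSymm.dotProduct_mulVec_le_of_orthogonal {n : ℕ}
    {C : Matrix (Fin n) (Fin n) ℝ} (hC : C.IsSymm) {lam1 lam2 : ℝ} {u : Fin n → ℝ}
    (hu : u ⬝ᵥ u = 1) (hCu : C *ᵥ u = lam1 • u)
    (hsec : ∀ (ν : ℝ) (x : Fin n → ℝ), x ≠ 0 → C *ᵥ x = ν • x → x ⬝ᵥ u = 0 → ν ≤ lam2)
    {z : Fin n → ℝ} (hz : z ⬝ᵥ u = 0) : z ⬝ᵥ C *ᵥ z ≤ lam2 * (z ⬝ᵥ z) := by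
  have hmul (x : Fin n → ℝ) : (C - (lam1 - lam2) • vecMulVec u u) *ᵥ x
      = C *ᵥ x - ((lam1 - lam2) * (x ⬝ᵥ u)) • u := by
    rw [sub_mulVec, smul_mulVec, vecMulVec_mulVec, dotProduct_comm u x]
    simp [smul_smul]
  have hsymm : (C - (lam1 - lam2) • vecMulVec u u).IsSymm := by
    rw [Matrix.IsSymm, transpose_sub, transpose_smul, transpose_vecMulVec, hC.eq]
  have hle := hsymm.dotProduct_mulVec_le_of_eigenvalue_le (m := lam2) (fun ν x hx hνx => by
    rw [hmul] at hνx
    by_cases hxu : x ⬝ᵥ u = 0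
    · exact hsec ν x hx (by simpa [hxu] using hνx) hxu
    · have huC : u ⬝ᵥ C *ᵥ x = lam1 * (x ⬝ᵥ u) := by
        rw [dotProduct_mulVec, ← mulVec_transpose, hC.eq, hCu, smul_dotProduct, smul_eq_mul,
          dotProduct_comm]
      have h := congrArg (u ⬝ᵥ ·) hνx
      simp only [dotProduct_sub, dotProduct_smul, smul_eq_mul, huC, hu,
        dotProduct_comm u x] at h
      exact (mul_right_cancel₀ hxu (by linarith)).le) z
  simpa [hmul, hz] using hle

open Matrix in
/-- A variant of the Davis-Kahan theorem: if `2 * ‖Ĉ - C‖` is smaller than the eigengap of `C`,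
then the leading unit eigenvectors differ by at most `2 * ‖Ĉ - C‖` over the eigengap. -/
theorem dotProduct_sub_self_le_of_eigengap {n : ℕ} {C Chat : Matrix (Fin n) (Fin n) ℝ}
    (hC : C.IsSymm) (hChat : Chat.IsSymm) {lam1 lam2 t : ℝ} {u v : Fin n → ℝ}
    (hu : u ⬝ᵥ u = 1) (hCu : C *ᵥ u = lam1 • u)
    (hsec : ∀ (ν : ℝ) (x : Fin n → ℝ), x ≠ 0 → C *ᵥ x = ν • x → x ⬝ᵥ u = 0 → ν ≤ lam2)
    (hpert : 2 * l2OpNorm (Chat - C) < lam1 - lam2)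
    (hv : v ⬝ᵥ v = 1) (hCv : Chat *ᵥ v = t • v)
    (ht : ∀ (ν : ℝ) (x : Fin n → ℝ), x ≠ 0 → Chat *ᵥ x = ν • x → ν ≤ t)
    (huv : 0 ≤ u ⬝ᵥ v) :
    (lam1 - lam2) ^ 2 * ((v - u) ⬝ᵥ (v - u)) ≤ (2 * l2OpNorm (Chat - C)) ^ 2 := by
  have hε : 0 ≤ l2OpNorm (Chat - C) := norm_nonneg _
  have hE := sq_dotProduct_mulVec_le_l2OpNorm (Chat - C)
  have hquad (x : Fin n → ℝ) :
      |x ⬝ᵥ (Chat - C) *ᵥ x| ≤ l2OpNorm (Chat - C) * (x ⬝ᵥ x) := by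
    apply abs_le_of_sq_le_sq _ (mul_nonneg hε (by simpa using dotProduct_star_self_nonneg x))
    nlinarith [hE x x]
  set ε := l2OpNorm (Chat - C)
  obtain ⟨a, ha⟩ : ∃ a, a = u ⬝ᵥ v := ⟨_, rfl⟩
  obtain ⟨z, hz⟩ : ∃ z, z = v - a • u := ⟨_, rfl⟩
  have hvz : v = a • u + z := by rw [hz]; abel
  have hvu : v ⬝ᵥ u = a := by rw [dotProduct_comm, ha]
  have hzu : z ⬝ᵥ u = 0 := by simp [hz, sub_dotProduct, hvu, hu]
  have huz : u ⬝ᵥ z = 0 := by rw [dotProduct_comm, hzu]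
  have hzv : z ⬝ᵥ v = z ⬝ᵥ z := by
    conv_lhs => rw [hvz]
    simp [dotProduct_add, hzu]
  have hzz : z ⬝ᵥ z = 1 - a ^ 2 := by
    rw [← hzv, hz]
    simp only [sub_dotProduct, smul_dotProduct, hv, ← ha, smul_eq_mul]
    ring
  have hzz0 : 0 ≤ z ⬝ᵥ z := by simpa using dotProduct_star_self_nonneg z
  have hzCz := hC.dotProduct_mulVec_le_of_orthogonal hu hCu hsec hzu
  have htu := hChat.dotProduct_mulVec_le_of_eigenvalue_le ht u
  have hEu := abs_le.1 (hquad u)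
  have hEz := abs_le.1 (hquad z)
  have hswap : z ⬝ᵥ Chat *ᵥ u = u ⬝ᵥ Chat *ᵥ z := by
    rw [dotProduct_mulVec, ← mulVec_transpose, hChat.eq, dotProduct_comm]
  have huCv := congrArg (u ⬝ᵥ ·) hCv
  have hzCv := congrArg (z ⬝ᵥ ·) hCv
  have hzCu : z ⬝ᵥ C *ᵥ u = 0 := by simp [hCu, hzu]
  have huCu : u ⬝ᵥ C *ᵥ u = lam1 := by simp [hCu, hu]
  have huCz : u ⬝ᵥ C *ᵥ z = 0 := by
    rw [dotProduct_mulVec, ← mulVec_transpose, hC.eq, dotProduct_comm, hzCu]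
  -- the component of the residual equation orthogonal to `v`
  have hy : (a • z - (z ⬝ᵥ z) • u) ⬝ᵥ (Chat - C) *ᵥ v
      = a * (lam1 * (z ⬝ᵥ z) - z ⬝ᵥ C *ᵥ z) := by
    rw [sub_mulVec, hCv]
    conv_lhs => rw [hvz]
    simp only [mulVec_add, mulVec_smul, sub_dotProduct, smul_dotProduct, dotProduct_sub,
      dotProduct_add, dotProduct_smul, smul_eq_mul, hzCu, huCu, huCz, hzu, huz, hu]
    ring
  have hyy : (a • z - (z ⬝ᵥ z) • u) ⬝ᵥ (a • z - (z ⬝ᵥ z) • u) = z ⬝ᵥ z := by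
    simp only [sub_dotProduct, smul_dotProduct, dotProduct_sub,
      dotProduct_smul, smul_eq_mul, hzu, huz, hu]
    rw [hzz]
    ring
  have hbound := hE (a • z - (z ⬝ᵥ z) • u) v
  rw [hy, hyy, hv] at hbound
  have hd : (v - u) ⬝ᵥ (v - u) = 2 - 2 * a := by
    simp only [sub_dotProduct, dotProduct_sub, hv, hu, hvu, ← ha]
    ring
  simp only [dotProduct_smul, smul_eq_mul, ← ha, hzv] at huCv hzCv
  rw [hvz] at huCv hzCv
  simp only [mulVec_add, mulVec_smul, dotProduct_add, dotProduct_smul, smul_eq_mul, hswap]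
    at huCv hzCv
  simp only [sub_mulVec, dotProduct_sub, huCu, hu, mul_one] at hEu hEz htu
  rw [hd]
  rw [← ha] at huv
  clear_value ε
  generalize z ⬝ᵥ C *ᵥ z = c at *
  generalize z ⬝ᵥ Chat *ᵥ z = R at *
  generalize u ⬝ᵥ Chat *ᵥ z = q at *
  generalize u ⬝ᵥ Chat *ᵥ u = A at *
  generalize z ⬝ᵥ z = S at *
  have hSa : S ≤ a ^ 2 := by
    by_contra! hlt
    have h1 : a ^ 2 * (t - A) = t * S - R := by linear_combination -a * huCv + hzCv
    have hS : 0 < S := (sq_nonneg a).trans_lt hlt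
    nlinarith [mul_nonneg (sub_nonneg.2 hlt.le) (sub_nonneg.2 htu),
      mul_pos hS (sub_pos.2 hpert), mul_le_mul_of_nonneg_left hEu.1 hzz0]
  have ha1 : a ≤ 1 := by nlinarith
  have hsin : a ^ 2 * (lam1 - lam2) ^ 2 * S ≤ ε ^ 2 := by
    rcases hzz0.eq_or_lt with h0 | hS
    · simpa [← h0] using sq_nonneg ε
    have h1 : (a * ((lam1 - lam2) * S)) ^ 2 ≤ (a * (lam1 * S - c)) ^ 2 := by
      have : 0 ≤ (lam1 - lam2) * S := mul_nonneg (by linarith) hzz0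
      gcongr
      linarith
    exact le_of_mul_le_mul_right (by linarith) hS
  have hpoly : 2 - 2 * a ≤ 4 * a ^ 2 * S := by
    have h2 : 1 ≤ 2 * a ^ 2 := by linarith
    have : 0 ≤ (1 - a) * (2 * a ^ 2 * (1 + a) - 1) :=
      mul_nonneg (by linarith) (by linarith [mul_nonneg (sq_nonneg a) huv])
    rw [hzz]
    linear_combination 2 * this
  linear_combination (lam1 - lam2) ^ 2 * hpoly + 4 * hsin

open Matrix in
/-- A vector at distance at most `r` from `u` orders `i, j` as `u` does and has positive sum,
provided that `r` is small enough. -/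
theorem sum_pos_and_lt_of_dotProduct_sub_self_le {n : ℕ} {u v : Fin n → ℝ} {i j : Fin n}
    {r : ℝ} (hr : 0 ≤ r) (hd : (v - u) ⬝ᵥ (v - u) ≤ r ^ 2)
    (hsum : r * √n < ∑ k, u k) (hij : r * √2 < u j - u i) :
    0 < ∑ k, v k ∧ v i < v j := by
  have hd' : ∑ k, (v k - u k) ^ 2 ≤ r ^ 2 := by simpa [dotProduct, sq] using hd
  constructor
  · have h1 : (∑ k, (v k - u k)) ^ 2 ≤ (r * √n) ^ 2 := by
      have := sq_sum_le_card_mul_sum_sq (s := Finset.univ) (f := fun k => v k - u k)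
      simp only [Finset.card_univ, Fintype.card_fin] at this
      rw [mul_pow, Real.sq_sqrt (Nat.cast_nonneg n)]
      nlinarith [mul_le_mul_of_nonneg_left hd' (Nat.cast_nonneg (α := ℝ) n)]
    have h2 := (abs_le.1 (abs_le_of_sq_le_sq h1 (by positivity))).1
    rw [Finset.sum_sub_distrib] at h2
    linarith
  · have hne : i ≠ j := by
      rintro rfl
      have : 0 ≤ r * √2 := by positivity
      linarith
    have h1 : (v i - u i) ^ 2 + (v j - u j) ^ 2 ≤ r ^ 2 := by
      rw [← Finset.sum_pair (f := fun k => (v k - u k) ^ 2) hne]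
      exact (Finset.sum_le_sum_of_subset_of_nonneg (Finset.subset_univ _)
        fun _ _ _ => sq_nonneg _).trans hd'
    have h2 : ((v j - u j) - (v i - u i)) ^ 2 ≤ (r * √2) ^ 2 := by
      rw [mul_pow, Real.sq_sqrt (by norm_num)]
      nlinarith [sq_nonneg ((v j - u j) + (v i - u i))]
    have h3 := (abs_le.1 (abs_le_of_sq_le_sq h2 (by positivity))).1
    linarith

/-- Theorem 2, matrix perturbation form. If the spectral-norm perturbation
`‖Ĉ − C‖₂` is smaller than `(δ/2) min((u_j − u_i)/√2, ⟨u, 1/√n⟩)`, where `δ = lam1 − lam2` is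
the eigengap of `C` and `u` its entrywise-nonnegative leading unit eigenvector, then the
sign-corrected leading unit eigenvector of `Ĉ` orders `i, j` (with `u_i < u_j`) correctly. -/
theorem pairwise_ordering_matrix_form
    {n : ℕ} (C Chat : Matrix (Fin n) (Fin n) ℝ)
    (hC : C.IsSymm) (hChat : Chat.IsSymm)
    (lam1 lam2 : ℝ) (hgap : lam2 < lam1)
    (u : Fin n → ℝ) (hu_unit : ∑ k, u k ^ 2 = 1) (hu_nonneg : ∀ k, 0 ≤ u k)
    (hu_eig : C.mulVec u = lam1 • u)
    (hmax : ∀ (ν : ℝ) (x : Fin n → ℝ), x ≠ 0 → C.mulVec x = ν • x → ν ≤ lam1)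
    (hsec : ∀ (ν : ℝ) (x : Fin n → ℝ), x ≠ 0 → C.mulVec x = ν • x →
      (∑ k, x k * u k) = 0 → ν ≤ lam2)
    (i j : Fin n) (hij : u i < u j)
    (hpert : l2OpNorm (Chat - C) <
      (lam1 - lam2) / 2 *
        min ((u j - u i) / Real.sqrt 2) (∑ k, u k * (1 / Real.sqrt (n : ℝ)))) :
    ∀ vhat : Fin n → ℝ, (∑ k, vhat k ^ 2 = 1) →
      (∃ t : ℝ, Chat.mulVec vhat = t • vhat ∧
        ∀ (ν : ℝ) (x : Fin n → ℝ), x ≠ 0 → Chat.mulVec x = ν • x → ν ≤ t) →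
      (Real.sign (∑ k, vhat k) • vhat) i < (Real.sign (∑ k, vhat k) • vhat) j := by
  rintro v hv ⟨t, hCv, ht⟩
  have hself (x : Fin n → ℝ) (hx : ∑ k, x k ^ 2 = 1) : dotProduct x x = 1 := by
    simpa [dotProduct, sq] using hx
  set ε := l2OpNorm (Chat - C)
  have hε : 0 ≤ ε := norm_nonneg _
  have hδ : 0 < lam1 - lam2 := sub_pos.2 hgap
  have hn : 0 < √(n : ℝ) := Real.sqrt_pos.2 (Nat.cast_pos.2 i.pos)
  have hlt : 2 * ε / (lam1 - lam2) <
      min ((u j - u i) / √2) (∑ k, u k * (1 / √(n : ℝ))) := by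
    rw [div_lt_iff₀ hδ]
    linarith
  rw [lt_min_iff, ← Finset.sum_mul, mul_one_div, lt_div_iff₀ (by positivity),
    lt_div_iff₀ hn] at hlt
  obtain ⟨hlt_ij, hlt_sum⟩ := hlt
  have hsum_le : ∑ k, u k ≤ √(n : ℝ) := by
    apply Real.le_sqrt_of_sq_le
    have := sq_sum_le_card_mul_sum_sq (s := Finset.univ) (f := u)
    simpa [hu_unit] using this
  have hpert' : 2 * ε < lam1 - lam2 := by
    rw [← div_lt_one hδ]
    exact lt_of_mul_lt_mul_right (by linarith) hn.le
  have key (w : Fin n → ℝ) (hw : dotProduct w w = 1) (hCw : Chat.mulVec w = t • w)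
      (huw : 0 ≤ dotProduct u w) : 0 < ∑ k, w k ∧ w i < w j := by
    apply sum_pos_and_lt_of_dotProduct_sub_self_le (by positivity) _ hlt_sum hlt_ij
    rw [div_pow, le_div_iff₀ (by positivity), mul_comm]
    exact dotProduct_sub_self_le_of_eigengap hC hChat (hself u hu_unit) hu_eig hsec hpert'
      hw hCw ht huw
  rcases le_total 0 (dotProduct u v) with h | h
  · obtain ⟨hpos, hlt⟩ := key v (hself v hv) hCv h
    simpa [Real.sign_of_pos hpos] using hlt
  · obtain ⟨hpos, hlt⟩ := key (-v) (by simpa using hself v hv)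
      (by rw [Matrix.mulVec_neg, hCv, smul_neg]) (by simpa using h)
    have hneg : ∑ k, v k < 0 := by simpa using hpos
    simpa [Real.sign_of_neg hneg] using hlt
end

section
/- (Davis–Kahan bound for the leading eigenvector, variant of Yu–Wang–Samworth used as Lemma 'Angle between û and u'.) Let C and Ĉ be real symmetric n×n matrices. Let λ₁ ≥ λ₂ be the two largest eigenvalues of C with δ = λ₁ − λ₂ > 0, let v be a unit eigenvector of C associated with λ₁, and let v̂ be a unit eigenvector of Ĉ associated with the largest eigenvalue of Ĉ. Then sin θ(v, v̂) = √(1 − ⟨v, v̂⟩²) ≤ 2‖Ĉ − C‖₂ / δ. -/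
open Matrix in
/-- Rayleigh bound: if every eigenvalue of a real symmetric matrix is at most `t`, then its
quadratic form is at most `t` times the squared norm. -/
lemma dotProduct_mulVec_le_of_eigenvalues_le {ι : Type*} [Fintype ι]
    {M : Matrix ι ι ℝ} (hM : M.IsSymm) {t : ℝ}
    (h : ∀ (ν : ℝ) (x : ι → ℝ), x ≠ 0 → M *ᵥ x = ν • x → ν ≤ t) (x : ι → ℝ) :
    x ⬝ᵥ M *ᵥ x ≤ t * (x ⬝ᵥ x) := by
  classical
  have hH : (t • (1 : Matrix ι ι ℝ) - M).IsHermitian := by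
    rw [IsHermitian, conjTranspose_eq_transpose_of_trivial, transpose_sub, transpose_smul,
      transpose_one, hM]
  have hP : (t • (1 : Matrix ι ι ℝ) - M).PosSemidef := by
    refine hH.posSemidef_iff_eigenvalues_nonneg.2 fun i => ?_
    have he := hH.mulVec_eigenvectorBasis i
    have hne : (hH.eigenvectorBasis i).ofLp ≠ 0 := fun h0 =>
      hH.eigenvectorBasis.orthonormal.ne_zero i (by ext j; exact congrFun h0 j)
    have hle := h (t - hH.eigenvalues i) _ hne (by
      rw [sub_smul, ← he, sub_mulVec, smul_mulVec, one_mulVec, sub_sub_cancel])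
    simp only [Pi.zero_apply]
    linarith
  have hq := hP.dotProduct_mulVec_nonneg x
  simp only [star_trivial, sub_mulVec, smul_mulVec, one_mulVec, dotProduct_sub,
    dotProduct_smul, smul_eq_mul] at hq
  linarith

open Matrix in
/-- Deflated Rayleigh bound: if `v` is a unit eigenvector for `lam1` and every eigenvalue with an
eigenvector orthogonal to `v` is at most `lam2`, then the quadratic form is bounded by
`lam2 ‖x‖² + (lam1 - lam2) ⟨v, x⟩²`. -/
lemma dotProduct_mulVec_le_of_eigenvalues_orthogonal_le {ι : Type*} [Fintype ι]
    {M : Matrix ι ι ℝ} (hM : M.IsSymm) {lam1 lam2 : ℝ} {v : ι → ℝ}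
    (hv : v ⬝ᵥ v = 1) (hMv : M *ᵥ v = lam1 • v)
    (h : ∀ (ν : ℝ) (x : ι → ℝ), x ≠ 0 → M *ᵥ x = ν • x → x ⬝ᵥ v = 0 → ν ≤ lam2)
    (x : ι → ℝ) :
    x ⬝ᵥ M *ᵥ x ≤ lam2 * (x ⬝ᵥ x) + (lam1 - lam2) * (v ⬝ᵥ x) ^ 2 := by
  have hmul (y : ι → ℝ) : (M - (lam1 - lam2) • vecMulVec v v) *ᵥ y =
      M *ᵥ y - ((lam1 - lam2) * (v ⬝ᵥ y)) • v := by
    rw [sub_mulVec, smul_mulVec, vecMulVec_mulVec, op_smul_eq_smul, smul_smul]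
  have hS : (M - (lam1 - lam2) • vecMulVec v v).IsSymm := by
    rw [IsSymm, transpose_sub, transpose_smul, transpose_vecMulVec, hM]
  have hq := dotProduct_mulVec_le_of_eigenvalues_le hS (t := lam2) (fun ν y hy hνy => by
    rw [hmul] at hνy
    have hvM : v ⬝ᵥ M *ᵥ y = lam1 * (v ⬝ᵥ y) := by
      rw [dotProduct_mulVec, ← mulVec_transpose, hM, hMv, smul_dotProduct, smul_eq_mul]
    have hin := congrArg (v ⬝ᵥ ·) hνy
    simp only [dotProduct_sub, dotProduct_smul, smul_eq_mul, hvM, hv] at hin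
    by_cases hvy : v ⬝ᵥ y = 0
    · refine h ν y hy ?_ (by rw [dotProduct_comm, hvy])
      simpa [hvy] using hνy
    · exact (mul_right_cancel₀ hvy (by linarith : ν * (v ⬝ᵥ y) = lam2 * (v ⬝ᵥ y))).le) x
  rw [hmul, dotProduct_sub, dotProduct_smul, smul_eq_mul, dotProduct_comm x v] at hq
  linarith

open Matrix in
/-- Cauchy–Schwarz bound for the bilinear form of a matrix by its spectral norm. -/
lemma dotProduct_mulVec_le_l2OpNorm {n : ℕ} (M : Matrix (Fin n) (Fin n) ℝ)
    (x y : Fin n → ℝ) :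
    x ⬝ᵥ M *ᵥ y ≤ l2OpNorm M * (√(x ⬝ᵥ x) * √(y ⬝ᵥ y)) := by
  have hnorm (z : Fin n → ℝ) : ‖WithLp.toLp 2 z‖ = √(z ⬝ᵥ z) := by
    simp [EuclideanSpace.norm_eq, dotProduct, sq]
  have hinner : x ⬝ᵥ M *ᵥ y = inner ℝ (WithLp.toLp 2 x)
      (toEuclideanCLM (𝕜 := ℝ) M (WithLp.toLp 2 y)) := by
    rw [toEuclideanCLM_toLp, EuclideanSpace.inner_toLp_toLp, star_trivial, dotProduct_comm]
  rw [hinner, ← hnorm, ← hnorm, l2OpNorm]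
  calc _ ≤ _ := real_inner_le_norm _ _
    _ ≤ ‖WithLp.toLp 2 x‖ * (‖toEuclideanCLM (𝕜 := ℝ) M‖ * ‖WithLp.toLp 2 y‖) := by
      gcongr
      exact ContinuousLinearMap.le_opNorm _ _
    _ = _ := by ring

open Matrix in
/-- Davis–Kahan bound for the leading eigenvector, Yu–Wang–Samworth
variant. Let `C, Ĉ` be real symmetric matrices, `lam1 > lam2` the two largest eigenvalues of
`C` with unit eigenvector `v` for `lam1`, and `v̂` a unit eigenvector of `Ĉ` associated with
its largest eigenvalue. Then `sin θ(v, v̂) ≤ 2‖Ĉ − C‖₂ / (lam1 − lam2)`. -/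
theorem davis_kahan_leading_eigenvector
    {n : ℕ} (C Chat : Matrix (Fin n) (Fin n) ℝ)
    (hC : C.IsSymm) (hChat : Chat.IsSymm)
    (lam1 lam2 : ℝ) (hgap : lam2 < lam1)
    (v : Fin n → ℝ) (hv_unit : ∑ k, v k ^ 2 = 1)
    (hv_eig : C.mulVec v = lam1 • v)
    (hmax : ∀ (ν : ℝ) (x : Fin n → ℝ), x ≠ 0 → C.mulVec x = ν • x → ν ≤ lam1)
    (hsec : ∀ (ν : ℝ) (x : Fin n → ℝ), x ≠ 0 → C.mulVec x = ν • x →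
      (∑ k, x k * v k) = 0 → ν ≤ lam2)
    (vhat : Fin n → ℝ) (hvhat_unit : ∑ k, vhat k ^ 2 = 1)
    (hvhat : ∃ t : ℝ, Chat.mulVec vhat = t • vhat ∧
      ∀ (ν : ℝ) (x : Fin n → ℝ), x ≠ 0 → Chat.mulVec x = ν • x → ν ≤ t) :
    Real.sqrt (1 - (∑ k, v k * vhat k) ^ 2) ≤
      2 * l2OpNorm (Chat - C) / (lam1 - lam2) := by
  obtain ⟨t, ht, htmax⟩ := hvhat
  have hv : v ⬝ᵥ v = 1 := by simpa [dotProduct, sq] using hv_unit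
  have hw : vhat ⬝ᵥ vhat = 1 := by simpa [dotProduct, sq] using hvhat_unit
  change √(1 - (v ⬝ᵥ vhat) ^ 2) ≤ _
  have hwv : vhat ⬝ᵥ v = v ⬝ᵥ vhat := dotProduct_comm _ _
  have hupper := dotProduct_mulVec_le_of_eigenvalues_orthogonal_le hC hv hv_eig hsec vhat
  have hlower := dotProduct_mulVec_le_of_eigenvalues_le hChat htmax v
  have hE : (Chat - C).IsSymm := hChat.sub hC
  have hcross : vhat ⬝ᵥ (Chat - C).mulVec v = v ⬝ᵥ (Chat - C).mulVec vhat := by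
    rw [dotProduct_mulVec, ← mulVec_transpose, hE, dotProduct_comm]
  have hCv : v ⬝ᵥ C.mulVec v = lam1 := by simp [hv_eig, hv]
  have hChatw : vhat ⬝ᵥ Chat.mulVec vhat = t := by simp [ht, hw]
  have hbound := dotProduct_mulVec_le_l2OpNorm (Chat - C) (vhat - v) (vhat + v)
  rw [← Real.sqrt_mul (by simpa using dotProduct_star_self_nonneg (vhat - v))] at hbound
  have hprod : ((vhat - v) ⬝ᵥ (vhat - v)) * ((vhat + v) ⬝ᵥ (vhat + v)) =
      2 ^ 2 * (1 - (v ⬝ᵥ vhat) ^ 2) := by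
    simp only [sub_dotProduct, dotProduct_sub, add_dotProduct, dotProduct_add, hv, hw, hwv]
    ring
  rw [hprod, Real.sqrt_mul (by norm_num), Real.sqrt_sq (by norm_num), mulVec_add,
    sub_dotProduct, dotProduct_add, dotProduct_add, hcross] at hbound
  simp only [sub_mulVec, dotProduct_sub, hCv, hChatw] at hbound
  rw [hv, mul_one] at hlower
  rw [hw, mul_one] at hupper
  rw [le_div_iff₀ (sub_pos.2 hgap)]
  have hN : 0 ≤ l2OpNorm (Chat - C) := norm_nonneg _
  rcases (Real.sqrt_nonneg (1 - (v ⬝ᵥ vhat) ^ 2)).eq_or_lt with h0 | hpos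
  · rw [← h0]
    linarith
  · have hsq := Real.sq_sqrt (Real.sqrt_pos.1 hpos).le
    set s := √(1 - (v ⬝ᵥ vhat) ^ 2)
    refine le_of_mul_le_mul_right ?_ hpos
    have hc : (v ⬝ᵥ vhat) ^ 2 = 1 - s ^ 2 := by linarith
    rw [hc] at hupper
    linarith
end

section
/- (Minimum guaranteed viable threshold.) Let u, û ∈ ℝⁿ be unit vectors with α = ⟨u, û⟩ ≥ 0. Then the threshold τ = √(2(1 − α²)) is viable: for all indices i, j, if û_j − û_i > √(2(1 − α²)) then u_j > u_i. -/
/-- The squared difference of two coordinates is at most twice the squared Euclidean norm. -/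
theorem sq_sub_le_two_mul_sum_sq {ι : Type*} [Fintype ι] (w : ι → ℝ) (i j : ι) :
    (w j - w i) ^ 2 ≤ 2 * ∑ k, w k ^ 2 := by
  classical
  rcases eq_or_ne i j with rfl | hij
  · have : 0 ≤ ∑ k, w k ^ 2 := Finset.sum_nonneg fun k _ => sq_nonneg (w k)
    simpa using this
  · have h : ∑ k ∈ {i, j}, w k ^ 2 ≤ ∑ k, w k ^ 2 :=
      Finset.sum_le_sum_of_subset_of_nonneg (Finset.subset_univ _) fun k _ _ => sq_nonneg (w k)
    rw [Finset.sum_pair hij] at h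
    nlinarith [sq_nonneg (w j + w i)]

/-- minimum guaranteed viable threshold. For unit vectors `u, û` with
`α = ⟨u, û⟩ ≥ 0`, the threshold `τ = √(2(1 − α²))` is viable: whenever
`û_j − û_i > √(2(1 − α²))`, also `u_j > u_i`. -/
theorem minimum_viable_threshold
    {n : ℕ} (u uhat : Fin n → ℝ)
    (hu_unit : ∑ k, u k ^ 2 = 1) (huhat_unit : ∑ k, uhat k ^ 2 = 1)
    (α : ℝ) (hα : α = ∑ k, u k * uhat k) (hα_nonneg : 0 ≤ α) :
    ∀ i j, Real.sqrt (2 * (1 - α ^ 2)) < uhat j - uhat i → u i < u j := by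
  intro i j hij
  by_contra! hle
  have hpos : 0 < uhat j - uhat i := (Real.sqrt_nonneg _).trans_lt hij
  have hresidual : ∑ k, (uhat k - α * u k) ^ 2 = 1 - α ^ 2 := by
    calc ∑ k, (uhat k - α * u k) ^ 2
        = ∑ k, (uhat k ^ 2 - 2 * α * (u k * uhat k) + α ^ 2 * u k ^ 2) :=
          Finset.sum_congr rfl fun k _ => by ring
      _ = 1 - α ^ 2 := by
          rw [Finset.sum_add_distrib, Finset.sum_sub_distrib, ← Finset.mul_sum,
            ← Finset.mul_sum, hu_unit, huhat_unit, ← hα]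
          ring
  have hbound := sq_sub_le_two_mul_sum_sq (fun k => uhat k - α * u k) i j
  simp only [hresidual] at hbound
  have hmono : uhat j - uhat i ≤ (uhat j - α * u j) - (uhat i - α * u i) := by
    linarith [mul_le_mul_of_nonneg_left hle hα_nonneg]
  have hsq := (pow_le_pow_left₀ hpos.le hmono 2).trans hbound
  exact hij.not_ge (Real.le_sqrt_of_sq_le hsq)
end

section
/- (The worst-case perturbation for one pair preserves all other pairwise orderings.) Let u ∈ ℝⁿ be a unit vector, let i ≠ j be indices with d = u_j − u_i > 0 and d² < 2, and let α ∈ (0, 1]. Define ε₀ = √((1 − α²)/(2 − d²)) · (e_i − e_j + d·u) and û = α·u + ε₀. Then for all indices k, l with k ∉ {i, j} and l ∉ {i, j}, û_l − û_k = (α + d·√((1 − α²)/(2 − d²))) · (u_l − u_k); in particular, u_k < u_l if and only if û_k < û_l. -/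
/-- the worst-case perturbation for one pair preserves all other pairwise
orderings. With `ε₀ = √((1 − α²)/(2 − d²)) (e_i − e_j + d u)` and `û = α u + ε₀`, for all
indices `k, l ∉ {i, j}` we have
`û_l − û_k = (α + d √((1 − α²)/(2 − d²))) (u_l − u_k)`; in particular
`u_k < u_l ↔ û_k < û_l`. -/
theorem worst_case_perturbation_preserves_other_orderings
    {n : ℕ} (u : Fin n → ℝ) (hu_unit : ∑ k, u k ^ 2 = 1)
    (i j : Fin n) (hij : i ≠ j)
    (d : ℝ) (hd : d = u j - u i) (hd_pos : 0 < d) (hd2 : d ^ 2 < 2)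
    (α : ℝ) (hα_pos : 0 < α) (hα_le : α ≤ 1)
    (ε₀ uhat : Fin n → ℝ)
    (hε₀ : ε₀ = Real.sqrt ((1 - α ^ 2) / (2 - d ^ 2)) •
      (Pi.single i (1 : ℝ) - Pi.single j (1 : ℝ) + d • u))
    (huhat : uhat = α • u + ε₀) :
    ∀ k l, k ≠ i → k ≠ j → l ≠ i → l ≠ j →
      (uhat l - uhat k =
        (α + d * Real.sqrt ((1 - α ^ 2) / (2 - d ^ 2))) * (u l - u k)) ∧
      (u k < u l ↔ uhat k < uhat l) := by
  intro k l hki hkj hli hlj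
  have key : uhat l - uhat k =
      (α + d * Real.sqrt ((1 - α ^ 2) / (2 - d ^ 2))) * (u l - u k) := by
    subst huhat hε₀
    simp only [Pi.add_apply, Pi.sub_apply, Pi.smul_apply, smul_eq_mul,
      Pi.single_eq_of_ne hki, Pi.single_eq_of_ne hkj, Pi.single_eq_of_ne hli,
      Pi.single_eq_of_ne hlj]
    ring
  have hpos : 0 < α + d * Real.sqrt ((1 - α ^ 2) / (2 - d ^ 2)) := by positivity
  refine ⟨key, ?_⟩
  rw [← sub_pos, ← sub_pos (a := uhat l), key, mul_pos_iff_of_pos_left hpos]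
end
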